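/- The two-dimensional Lebesgue measure of the set { (u,v) ∈ (0,1) × (0,1) : max u v − min u v < 3 · (1 − max u v) · (min u v) } equals (15 − 16 ln 2)/9. -/

import Mathlib

/-- The cross-ratio condition on `(0,1)²` cuts out the region between two hyperbolic arcs. -/
theorem crossRatio_set_eq_regionBetween :
    {p : ℝ × ℝ | p.1 ∈ Set.Ioo (0 : ℝ) 1 ∧ p.2 ∈ Set.Ioo (0 : ℝ) 1 ∧
        max p.1 p.2 - min p.1 p.2 < 3 * (1 - max p.1 p.2) * min p.1 p.2} =
      regionBetween (fun u : ℝ => u / (4 - 3 * u)) (fun u : ℝ => 4 * u / (1 + 3 * u))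
        (Set.Ioo 0 1) := by
  ext ⟨u, v⟩
  simp only [regionBetween, Set.mem_ofPred_eq, Set.mem_Ioo]
  refine and_congr_right fun ⟨hu0, hu1⟩ => ?_
  have h4 : 0 < 4 - 3 * u := by linarith
  have h1 : 0 < 1 + 3 * u := by linarith
  rw [div_lt_iff₀ h4, lt_div_iff₀ h1]
  rcases le_total u v with h | h
  · rw [max_eq_right h, min_eq_left h]
    constructor
    · rintro ⟨-, hv⟩
      exact ⟨by nlinarith, by linarith⟩
    · rintro ⟨-, hv⟩
      exact ⟨⟨by linarith, by nlinarith⟩, by linarith⟩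
  · rw [max_eq_left h, min_eq_right h]
    constructor
    · rintro ⟨-, hv⟩
      exact ⟨by linarith, by nlinarith⟩
    · rintro ⟨hv, -⟩
      exact ⟨⟨by nlinarith, by linarith⟩, by linarith⟩

theorem integral_sub_hyperbolic_arcs :
    ∫ u in (0 : ℝ)..1, (4 * u / (1 + 3 * u) - u / (4 - 3 * u)) =
      (15 - 16 * Real.log 2) / 9 := by
  have hlog : Real.log 4 = 2 * Real.log 2 := by
    rw [show (4 : ℝ) = 2 ^ 2 by norm_num, Real.log_pow]
    norm_num
  rw [intervalIntegral.integral_eq_sub_of_hasDerivAt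
    (f := fun u : ℝ => 5 / 3 * u - 4 / 9 * Real.log (1 + 3 * u) + 4 / 9 * Real.log (4 - 3 * u))]
  · norm_num [hlog]
    ring
  · intro u hu
    rw [Set.uIcc_of_le zero_le_one] at hu
    have h4 : 4 - 3 * u ≠ 0 := by linarith [hu.2]
    have h1 : 1 + 3 * u ≠ 0 := by linarith [hu.1]
    have hid := hasDerivAt_id' u
    refine HasDerivAt.congr_deriv (((hid.const_mul (5 / 3)).sub
      ((((hid.const_mul 3).const_add 1).log h1).const_mul (4 / 9))).add
      ((((hid.const_mul 3).const_sub 4).log h4).const_mul (4 / 9))) ?_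
    field_simp
    ring
  · refine ContinuousOn.intervalIntegrable fun u hu => ?_
    rw [Set.uIcc_of_le zero_le_one] at hu
    have h4 : 4 - 3 * u ≠ 0 := by linarith [hu.2]
    have h1 : 1 + 3 * u ≠ 0 := by linarith [hu.1]
    exact ContinuousAt.continuousWithinAt (by fun_prop (disch := assumption))

theorem euclidean_probability :
    MeasureTheory.volume
        {p : ℝ × ℝ | p.1 ∈ Set.Ioo (0 : ℝ) 1 ∧ p.2 ∈ Set.Ioo (0 : ℝ) 1 ∧
          max p.1 p.2 - min p.1 p.2 < 3 * (1 - max p.1 p.2) * min p.1 p.2} =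
      ENNReal.ofReal ((15 - 16 * Real.log 2) / 9) := by
  rw [crossRatio_set_eq_regionBetween, MeasureTheory.Measure.volume_eq_prod,
    volume_regionBetween_eq_integral _ _ measurableSet_Ioo,
    ← integral_sub_hyperbolic_arcs, intervalIntegral.integral_of_le zero_le_one,
    MeasureTheory.integral_Ioc_eq_integral_Ioo]
  · rfl
  · intro u hu
    have h4 : 0 < 4 - 3 * u := by linarith [hu.2]
    have h1 : 0 < 1 + 3 * u := by linarith [hu.1]
    rw [div_le_div_iff₀ h4 h1]
    nlinarith [mul_pos hu.1 (sub_pos.2 hu.2)]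
  · refine (ContinuousOn.integrableOn_Icc fun u hu => ?_).mono_set Set.Ioo_subset_Icc_self
    have h4 : 4 - 3 * u ≠ 0 := by linarith [hu.2]
    exact ContinuousAt.continuousWithinAt (by fun_prop (disch := assumption))
  · refine (ContinuousOn.integrableOn_Icc fun u hu => ?_).mono_set Set.Ioo_subset_Icc_self
    have h1 : 1 + 3 * u ≠ 0 := by linarith [hu.1]
    exact ContinuousAt.continuousWithinAt (by fun_prop (disch := assumption))
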